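/- (Strassen's theorem.) Let μ and ν be finite Borel measures on a complete separable metric space Z with μ(Z) = ν(Z), and let ε := dP(μ,ν). Then there exists a coupling α of μ and ν (i.e., a Borel measure α on Z × Z with π₁_*α = μ and π₂_*α = ν) such that α({(x,y) ∈ Z × Z : d(x,y) > ε}) ≤ ε. -/

import Mathlib

open MeasureTheory Topology Filter

noncomputable section

/-- Prokhorov distance between finite Borel measures on a metric space. -/
def prokhorovDist {Z : Type*} [MetricSpace Z] [MeasurableSpace Z]
    (μ ν : Measure Z) : ℝ :=
  sInf {ε : ℝ | 0 < ε ∧ ∀ A : Set Z, IsClosed A →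
    μ A ≤ ν (Metric.cthickening ε A) + ENNReal.ofReal ε ∧
    ν A ≤ μ (Metric.cthickening ε A) + ENNReal.ofReal ε}


open Classical in
lemma hall_frac {I J : Type*} [Fintype I] [Fintype J] (p : I → ℝ) (q : J → ℝ)
    (hp : ∀ i, 0 ≤ p i) (hq : ∀ j, 0 ≤ q j) (R : I → J → Prop) (δ : ℝ) (hδ : 0 ≤ δ)
    (h : ∀ S : Finset I, ∑ i ∈ S, p i ≤ (∑ j with ∃ i ∈ S, R i j, q j) + δ)
    (η : ℝ) (hη : 0 < η) :
    ∃ w : I → J → ℝ, (∀ i j, 0 ≤ w i j) ∧ (∀ i j, ¬ R i j → w i j = 0) ∧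
      (∀ i, ∑ j, w i j ≤ p i) ∧ (∀ j, ∑ i, w i j ≤ q j) ∧
      ∑ i, p i - δ - η ≤ ∑ i, ∑ j, w i j := by
  obtain ⟨N, hN⟩ := exists_nat_gt ((Fintype.card I + Fintype.card J + 1 : ℝ) / η)
  have hN0 : (0 : ℝ) < N := lt_of_le_of_lt (by positivity) hN
  have hNη : (Fintype.card I + Fintype.card J + 1 : ℝ) ≤ N * η := by
    rw [div_lt_iff₀ hη] at hN; exact hN.le
  set a : I → ℕ := fun i => ⌊N * p i⌋₊ with ha
  set b : J → ℕ := fun j => ⌊N * q j⌋₊ with hb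
  set D : ℕ := ⌈N * δ⌉₊ + Fintype.card J with hD
  have ha1 : ∀ i, (a i : ℝ) ≤ N * p i := fun i => Nat.floor_le (by have := hp i; positivity)
  have ha2 : ∀ i, N * p i ≤ (a i : ℝ) + 1 := fun i => (Nat.lt_floor_add_one _).le
  have hb1 : ∀ i, (b i : ℝ) ≤ N * q i := fun i => Nat.floor_le (by have := hq i; positivity)
  have hb2 : ∀ i, N * q i ≤ (b i : ℝ) + 1 := fun i => (Nat.lt_floor_add_one _).le
  have hD1 : N * δ + Fintype.card J ≤ (D : ℝ) := by
    rw [hD]; push_cast; have := Nat.le_ceil (N * δ); linarith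
  have hD2 : (D : ℝ) ≤ N * δ + 1 + Fintype.card J := by
    rw [hD]; push_cast; have := Nat.ceil_lt_add_one (show 0 ≤ N * δ by positivity); linarith
  let X := (i : I) × Fin (a i)
  let Y := ((j : J) × Fin (b j)) ⊕ Fin D
  let g : Y → Option J := Sum.elim (fun y => some y.1) (fun _ => none)
  let t : X → Finset Y := fun x => Finset.univ.filter (fun y => ∀ j, g y = some j → R x.1 j)
  have hall : ∀ s : Finset X, s.card ≤ (s.biUnion t).card := by
    intro s
    rcases s.eq_empty_or_nonempty with rfl | ⟨x0, hx0⟩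
    · simp
    set S : Finset I := s.image Sigma.fst with hS
    have h1 : (s.card : ℝ) ≤ ∑ i ∈ S, (a i : ℝ) := by
      have : s ⊆ S.sigma (fun i => (Finset.univ : Finset (Fin (a i)))) := by
        intro x hx
        rw [Finset.mem_sigma]
        exact ⟨Finset.mem_image.2 ⟨x, hx, rfl⟩, Finset.mem_univ _⟩
      have := Finset.card_le_card this
      rw [Finset.card_sigma] at this
      simp only [Finset.card_univ, Fintype.card_fin] at this
      exact_mod_cast this
    set T : Finset J := Finset.univ.filter (fun j => ∃ i ∈ S, R i j) with hT
    have h2 : ((∑ j ∈ T, b j : ℕ) : ℝ) + D ≤ ((s.biUnion t).card : ℝ) := by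
      have : (T.sigma (fun j => (Finset.univ : Finset (Fin (b j))))).disjSum
          (Finset.univ : Finset (Fin D)) ⊆ s.biUnion t := by
        intro y hy
        rw [Finset.mem_disjSum] at hy
        rw [Finset.mem_biUnion]
        rcases hy with ⟨⟨j, k⟩, hj, rfl⟩ | ⟨k, _, rfl⟩
        · simp only [Finset.mem_sigma, Finset.mem_univ, and_true, hT, Finset.mem_filter,
            true_and, hS, Finset.mem_image] at hj
          obtain ⟨i, ⟨x, hx, rfl⟩, hR⟩ := hj
          refine ⟨x, hx, ?_⟩
          simp only [t, Finset.mem_filter, Finset.mem_univ, true_and, g, Sum.elim_inl,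
            Option.some.injEq]
          rintro _ rfl
          exact hR
        · exact ⟨x0, hx0, by simp [t, g]⟩
      have := Finset.card_le_card this
      rw [Finset.card_disjSum, Finset.card_sigma] at this
      simp only [Finset.card_univ, Fintype.card_fin] at this
      exact_mod_cast this
    have h3 := h S
    have h4 : ∑ i ∈ S, (a i : ℝ) ≤ N * ∑ i ∈ S, p i := by
      rw [Finset.mul_sum]; exact Finset.sum_le_sum fun i _ => ha1 i
    have h5 : N * ∑ j ∈ T, q j ≤ ∑ j ∈ T, (b j : ℝ) + Fintype.card J := by
      rw [Finset.mul_sum]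
      calc ∑ j ∈ T, N * q j ≤ ∑ j ∈ T, ((b j : ℝ) + 1) := Finset.sum_le_sum fun i _ => hb2 i
        _ = ∑ j ∈ T, (b j : ℝ) + T.card := by simp [Finset.sum_add_distrib]
        _ ≤ _ := by
          have : (T.card : ℝ) ≤ Fintype.card J := by exact_mod_cast Finset.card_le_univ T
          linarith
    have h6 : N * ∑ i ∈ S, p i ≤ N * ((∑ j ∈ T, q j) + δ) :=
      mul_le_mul_of_nonneg_left h3 hN0.le
    have : (s.card : ℝ) ≤ ((s.biUnion t).card : ℝ) := by
      push_cast at h2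
      linarith
    exact_mod_cast this
  obtain ⟨f, hf, hft⟩ := (Finset.all_card_le_biUnion_card_iff_exists_injective t).1 hall
  have hfR : ∀ x j, g (f x) = some j → R x.1 j := by
    intro x; have := hft x; simpa [t] using this
  let c : I → J → ℝ := fun i j => ∑ x : X, if x.1 = i ∧ g (f x) = some j then (1 : ℝ) else 0
  have hinj : ∀ F : Y → ℝ, (∀ y, 0 ≤ F y) → ∑ x, F (f x) ≤ ∑ y, F y := by
    intro F hF
    rw [← Finset.sum_image (f := F) (s := Finset.univ) (g := f) (fun x _ y _ h => hf h)]
    exact Finset.sum_le_sum_of_subset_of_nonneg (Finset.subset_univ _) (fun y _ _ => hF y)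
  have hrow : ∀ i, ∑ j, c i j ≤ N * p i := by
    intro i
    refine le_trans ?_ (ha1 i)
    simp only [c]
    rw [Finset.sum_comm]
    calc ∑ x : X, ∑ j, (if x.1 = i ∧ g (f x) = some j then (1 : ℝ) else 0)
        ≤ ∑ x : X, if x.1 = i then (1 : ℝ) else 0 := by
          refine Finset.sum_le_sum fun x _ => ?_
          by_cases hx : x.1 = i
          · rcases hgx : g (f x) with _ | j0 <;> simp [hx]
          · simp [hx]
      _ = a i := by
          rw [Fintype.sum_sigma, Finset.sum_eq_single i]
          · simp
          · intro k _ hk; simp [hk]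
          · simp
  have hcol : ∀ j, ∑ i, c i j ≤ N * q j := by
    intro j
    refine le_trans ?_ (hb1 j)
    simp only [c]
    rw [Finset.sum_comm]
    calc ∑ x : X, ∑ i, (if x.1 = i ∧ g (f x) = some j then (1 : ℝ) else 0)
        = ∑ x : X, if g (f x) = some j then (1 : ℝ) else 0 := by
          refine Finset.sum_congr rfl fun x _ => ?_
          by_cases hx : g (f x) = some j <;> simp [hx]
      _ ≤ ∑ y : Y, if g y = some j then (1 : ℝ) else 0 :=
          hinj (fun y => if g y = some j then (1 : ℝ) else 0) (fun y => by positivity)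
      _ = b j := by
          rw [Fintype.sum_sum_type, Fintype.sum_sigma]
          simp [g]
  have htot : N * ∑ i, p i - Fintype.card I - D ≤ ∑ i, ∑ j, c i j := by
    have e1 : ∑ i, ∑ j, c i j = ∑ x : X, (1 - if g (f x) = none then (1 : ℝ) else 0) := by
      simp only [c]
      have : ∀ i, ∑ j, ∑ x : X, (if x.1 = i ∧ g (f x) = some j then (1 : ℝ) else 0)
        = ∑ x : X, ∑ j, (if x.1 = i ∧ g (f x) = some j then (1 : ℝ) else 0) :=
          fun i => Finset.sum_comm
      rw [Finset.sum_congr rfl fun i _ => this i, Finset.sum_comm]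
      refine Finset.sum_congr rfl fun x _ => ?_
      rw [Finset.sum_eq_single x.1]
      · rcases hgx : g (f x) with _ | j0 <;> simp
      · intro i _ hi; simp [hi.symm]
      · simp
    have e2 : ∑ x : X, (if g (f x) = none then (1 : ℝ) else 0) ≤ D := by
      refine (hinj (fun y => if g y = none then (1 : ℝ) else 0) (fun y => by positivity)).trans ?_
      rw [Fintype.sum_sum_type]
      simp [g]
    have e3 : ∑ x : X, (1 : ℝ) = ∑ i, (a i : ℝ) := by
      rw [Fintype.sum_sigma]; simp
    have e4 : N * ∑ i, p i ≤ ∑ i, (a i : ℝ) + Fintype.card I := by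
      rw [Finset.mul_sum]
      refine (Finset.sum_le_sum fun i _ => ha2 i).trans ?_
      simp [Finset.sum_add_distrib]
    rw [e1, Finset.sum_sub_distrib, e3]
    linarith
  refine ⟨fun i j => c i j / N, ?_, ?_, ?_, ?_, ?_⟩
  · intro i j
    have : 0 ≤ c i j := Finset.sum_nonneg fun x _ => by positivity
    positivity
  · intro i j hR
    have : c i j = 0 := by
      refine Finset.sum_eq_zero fun x _ => ?_
      rw [if_neg]
      rintro ⟨rfl, h2⟩
      exact hR (hfR x j h2)
    simp [this]
  · intro i
    rw [← Finset.sum_div, div_le_iff₀ hN0]; linarith [hrow i]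
  · intro j
    rw [← Finset.sum_div, div_le_iff₀ hN0]; linarith [hcol j]
  · simp_rw [← Finset.sum_div]
    rw [le_div_iff₀ hN0]
    nlinarith

open Classical in
lemma hall_coupling {I J : Type*} [Fintype I] [Fintype J] (p : I → ℝ) (q : J → ℝ)
    (hp : ∀ i, 0 ≤ p i) (hq : ∀ j, 0 ≤ q j) (hpq : ∑ i, p i = ∑ j, q j)
    (R : I → J → Prop) (δ : ℝ) (hδ : 0 ≤ δ)
    (h : ∀ S : Finset I, ∑ i ∈ S, p i ≤ (∑ j with ∃ i ∈ S, R i j, q j) + δ)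
    (η : ℝ) (hη : 0 < η) :
    ∃ w : I → J → ℝ, (∀ i j, 0 ≤ w i j) ∧
      (∀ i, ∑ j, w i j = p i) ∧ (∀ j, ∑ i, w i j = q j) ∧
      ∑ i, ∑ j, (if R i j then 0 else w i j) ≤ δ + η := by
  obtain ⟨w, hw0, hwR, hwp, hwq, hwt⟩ := hall_frac p q hp hq R δ hδ h η hη
  set r : I → ℝ := fun i => p i - ∑ j, w i j with hr
  set s : J → ℝ := fun j => q j - ∑ i, w i j with hs
  set m : ℝ := ∑ i, r i with hm
  have hr0 : ∀ i, 0 ≤ r i := fun i => sub_nonneg.2 (hwp i)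
  have hs0 : ∀ i, 0 ≤ s i := fun i => sub_nonneg.2 (hwq i)
  have hm0 : 0 ≤ m := Finset.sum_nonneg fun i _ => hr0 i
  have hms : m = ∑ j, s j := by
    simp only [hm, hr, hs, Finset.sum_sub_distrib]
    rw [hpq, Finset.sum_comm]
  have hmle : m ≤ δ + η := by
    simp only [hm, hr, Finset.sum_sub_distrib]; linarith
  have hrm : ∀ i, r i * m / m = r i := by
    intro i
    by_cases h0 : m = 0
    · have := (Finset.sum_eq_zero_iff_of_nonneg (fun i _ => hr0 i)).1 h0 i (Finset.mem_univ i)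
      simp [this]
    · field_simp
  have hsm : ∀ i, m * s i / m = s i := by
    intro i
    by_cases h0 : m = 0
    · have := (Finset.sum_eq_zero_iff_of_nonneg (fun i _ => hs0 i)).1 (hms ▸ h0) i
        (Finset.mem_univ i)
      simp [this]
    · field_simp
  refine ⟨fun i j => w i j + r i * s j / m, ?_, ?_, ?_, ?_⟩
  · intro i j
    have := hw0 i j; have := hr0 i; have := hs0 j
    positivity
  · intro i
    rw [Finset.sum_add_distrib, ← Finset.sum_div, ← Finset.mul_sum, ← hms, hrm]
    simp [hr]
  · intro j
    rw [Finset.sum_add_distrib, ← Finset.sum_div, ← Finset.sum_mul, ← hm, hsm]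
    simp [hs]
  · refine le_trans ?_ hmle
    calc _ ≤ ∑ i, ∑ j, r i * s j / m := by
          refine Finset.sum_le_sum fun i _ => Finset.sum_le_sum fun j _ => ?_
          have := hr0 i; have := hs0 j
          split_ifs with hR
          · positivity
          · simp [hwR i j hR]
      _ = m := by
          have : ∀ i, ∑ j, r i * s j / m = r i := fun i => by
            rw [← Finset.sum_div, ← Finset.mul_sum, ← hms, hrm]
          exact Finset.sum_congr rfl fun i _ => this i


open Classical in
lemma glue {Z I : Type*} [MeasurableSpace Z] [Fintype I] (μ ν : Measure Z)
    [IsFiniteMeasure μ] [IsFiniteMeasure ν]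
    (A : I → Set Z) (hAm : ∀ i, MeasurableSet (A i)) (hAd : Pairwise (Function.onFun Disjoint A))
    (hAu : ⋃ i, A i = Set.univ) (w : I → I → ℝ) (hw0 : ∀ i j, 0 ≤ w i j)
    (hw1 : ∀ i, ∑ j, w i j = μ.real (A i)) (hw2 : ∀ j, ∑ i, w i j = ν.real (A j))
    (R : I → I → Prop) (B : Set (Z × Z))
    (hB : ∀ i j, R i j → ∀ x ∈ A i, ∀ y ∈ A j, (x, y) ∉ B) (d : ℝ)
    (hd : ∑ i, ∑ j, (if R i j then 0 else w i j) ≤ d) :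
    ∃ α : Measure (Z × Z), α.map Prod.fst = μ ∧ α.map Prod.snd = ν ∧
      α B ≤ ENNReal.ofReal d := by
  let P : I → Measure Z := fun i => ProbabilityTheory.cond μ (A i)
  let Q : I → Measure Z := fun i => ProbabilityTheory.cond ν (A i)
  have hcond : ∀ (m : Measure Z) [IsFiniteMeasure m] (S : Set Z), (ProbabilityTheory.cond m S) Set.univ ≤ 1 := by
    intro m _ S
    by_cases h : m S = 0
    · simp [ProbabilityTheory.cond_eq_zero_of_meas_eq_zero h]
    · have := ProbabilityTheory.cond_isProbabilityMeasure h
      simp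
  have hcond1 : ∀ (m : Measure Z) [IsFiniteMeasure m] (S : Set Z) (r : ℝ), 0 ≤ r → r ≤ m.real S →
      ENNReal.ofReal r * (ProbabilityTheory.cond m S) Set.univ = ENNReal.ofReal r := by
    intro m _ S r h0 h1
    by_cases h : m S = 0
    · have : r = 0 := by rw [measureReal_def, h] at h1; simp at h1; linarith
      simp [this]
    · have := ProbabilityTheory.cond_isProbabilityMeasure h
      simp
  have hsum : ∀ (m : Measure Z) [IsFiniteMeasure m] (s : Set Z), MeasurableSet s →
      ∑ i, ENNReal.ofReal (m.real (A i)) * (ProbabilityTheory.cond m (A i)) s = m s := by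
    intro m _ s hs
    have : ∀ i, ENNReal.ofReal (m.real (A i)) * (ProbabilityTheory.cond m (A i)) s
        = m (A i ∩ s) := by
      intro i
      rw [ofReal_measureReal, mul_comm, ProbabilityTheory.cond_mul_eq_inter (hAm i)]
    simp_rw [this]
    rw [← tsum_fintype (L := .unconditional _), ← measure_iUnion (fun i j hij => (hAd hij).mono Set.inter_subset_left Set.inter_subset_left)
      (fun i => (hAm i).inter hs), ← Set.iUnion_inter, hAu, Set.univ_inter]
  have : ∀ i, IsFiniteMeasure (P i) := fun i => ⟨(hcond μ _).trans_lt ENNReal.one_lt_top⟩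
  have : ∀ i, IsFiniteMeasure (Q i) := fun i => ⟨(hcond ν _).trans_lt ENNReal.one_lt_top⟩
  let α : Measure (Z × Z) := ∑ i, ∑ j, ENNReal.ofReal (w i j) • (P i).prod (Q j)
  have hα : ∀ s, α s = ∑ i, ∑ j, ENNReal.ofReal (w i j) * ((P i).prod (Q j)) s := by
    intro s
    simp [α]
  have hwle1 : ∀ i j, w i j ≤ μ.real (A i) := fun i j => by
    rw [← hw1]; exact Finset.single_le_sum (f := fun j => w i j) (fun j _ => hw0 i j) (Finset.mem_univ j)
  have hwle2 : ∀ i j, w i j ≤ ν.real (A j) := fun i j => by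
    rw [← hw2]; exact Finset.single_le_sum (f := fun i => w i j) (fun i _ => hw0 i j) (Finset.mem_univ i)
  refine ⟨α, ?_, ?_, ?_⟩
  · ext s hs
    rw [Measure.map_apply measurable_fst hs, hα, ← hsum μ s hs, ← Set.prod_univ]
    refine Finset.sum_congr rfl fun i _ => ?_
    rw [← hw1, ENNReal.ofReal_sum_of_nonneg (fun j _ => hw0 i j), Finset.sum_mul]
    refine Finset.sum_congr rfl fun j _ => ?_
    rw [Measure.prod_prod, mul_comm (P i s), ← mul_assoc, hcond1 ν _ _ (hw0 i j) (hwle2 i j)]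
  · ext s hs
    rw [Measure.map_apply measurable_snd hs, hα, ← hsum ν s hs, ← Set.univ_prod, Finset.sum_comm]
    refine Finset.sum_congr rfl fun j _ => ?_
    rw [← hw2, ENNReal.ofReal_sum_of_nonneg (fun i _ => hw0 i j), Finset.sum_mul]
    refine Finset.sum_congr rfl fun i _ => ?_
    rw [Measure.prod_prod, ← mul_assoc, hcond1 μ _ _ (hw0 i j) (hwle1 i j)]
  · rw [hα]
    refine le_trans ?_ (ENNReal.ofReal_le_ofReal hd)
    have h0 : ∀ i j, 0 ≤ (if R i j then 0 else w i j) := fun i j => by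
      have := hw0 i j
      split_ifs <;> simp [this]
    rw [ENNReal.ofReal_sum_of_nonneg (fun i _ => Finset.sum_nonneg fun j _ => h0 i j)]
    refine Finset.sum_le_sum fun i _ => ?_
    rw [ENNReal.ofReal_sum_of_nonneg (fun j _ => h0 i j)]
    refine Finset.sum_le_sum fun j _ => ?_
    split_ifs with hR
    · have hsub : B ⊆ ((A i)ᶜ ×ˢ Set.univ) ∪ (Set.univ ×ˢ (A j)ᶜ) := by
        rintro ⟨x, y⟩ hxy
        by_contra hcon
        simp at hcon
        exact hB i j hR x hcon.1 y hcon.2 hxy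
      have hz : ∀ m : Measure Z, ∀ i, (ProbabilityTheory.cond m (A i)) (A i)ᶜ = 0 := fun m i => by
        rw [ProbabilityTheory.cond_apply (hAm i)]; simp
      have : ((P i).prod (Q j)) B = 0 := by
        refine measure_mono_null hsub (measure_union_null ?_ ?_)
        · rw [Measure.prod_prod, hz, zero_mul]
        · rw [Measure.prod_prod, hz, mul_zero]
      simp [this]
    · calc _ ≤ ENNReal.ofReal (w i j) * 1 := by
            gcongr
            refine (measure_mono (Set.subset_univ _)).trans ?_
            rw [← Set.univ_prod_univ, Measure.prod_prod]
            exact mul_le_one' (hcond μ _) (hcond ν _)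
        _ = _ := mul_one _

lemma partition_fin {Z : Type*} [MetricSpace Z] [TopologicalSpace.SeparableSpace Z] [Nonempty Z]
    [MeasurableSpace Z] [BorelSpace Z] (m : Measure Z) [IsFiniteMeasure m] (δ η : ℝ)
    (hδ : 0 < δ) (hη : 0 < η) :
    ∃ (n : ℕ) (A : Option (Fin n) → Set Z), (∀ i, MeasurableSet (A i)) ∧
      Pairwise (Function.onFun Disjoint A) ∧ ⋃ i, A i = Set.univ ∧
      (∀ k, ∀ x ∈ A (some k), ∀ y ∈ A (some k), dist x y ≤ δ) ∧ m.real (A none) ≤ η := by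
  let u := TopologicalSpace.denseSeq Z
  let b : ℕ → Set Z := fun k => Metric.ball (u k) (δ / 2)
  have hb : ⋃ k, b k = Set.univ := by
    rw [Set.eq_univ_iff_forall]
    intro x
    obtain ⟨y, hy, k, rfl⟩ := Metric.dense_iff.1 (TopologicalSpace.denseRange_denseSeq Z) x (δ / 2) (by positivity)
    exact Set.mem_iUnion.2 ⟨k, by simpa [b, Metric.mem_ball, dist_comm] using hy⟩
  let E : ℕ → Set Z := fun n => (⋃ k, ⋃ (_ : k < n), b k)ᶜ
  have hbm : ∀ k, MeasurableSet (b k) := fun k => measurableSet_ball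
  have hEm : ∀ n, MeasurableSet (E n) := fun n =>
    (MeasurableSet.iUnion fun k => MeasurableSet.iUnion fun _ => hbm k).compl
  have hE : Tendsto (fun n => m (E n)) atTop (𝓝 0) := by
    have h1 : ⋂ n, E n = ∅ := by
      rw [Set.eq_empty_iff_forall_notMem]
      intro x hx
      obtain ⟨k, hk⟩ := Set.mem_iUnion.1 (hb ▸ Set.mem_univ x : x ∈ ⋃ k, b k)
      have := Set.mem_iInter.1 hx (k + 1)
      exact this (Set.mem_iUnion₂.2 ⟨k, Nat.lt_succ_self k, hk⟩)
    have := tendsto_measure_iInter_atTop (μ := m) (s := E) (fun n => (hEm n).nullMeasurableSet)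
      (fun i j hij => Set.compl_subset_compl.2 (Set.iUnion₂_subset fun k hk =>
        Set.subset_iUnion₂_of_subset k (hk.trans_le hij) subset_rfl)) ⟨0, measure_ne_top _ _⟩
    rwa [h1, measure_empty] at this
  obtain ⟨n, hn⟩ := (hE.eventually (gt_mem_nhds (ENNReal.ofReal_pos.2 hη))).exists
  refine ⟨n, fun o => o.elim (E n) (fun k => disjointed b k), ?_, ?_, ?_, ?_, ?_⟩
  · rintro (_ | k)
    · exact hEm n
    · exact MeasurableSet.disjointed hbm _
  · have hd : ∀ k : Fin n, Disjoint (E n) (disjointed b k) := by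
      intro k
      rw [Set.disjoint_left]
      intro x hx hx'
      exact hx (Set.mem_iUnion₂.2 ⟨k, k.2, disjointed_subset b k hx'⟩)
    rintro (_ | k) (_ | l) h
    · exact absurd rfl h
    · exact hd l
    · exact (hd k).symm
    · refine disjoint_disjointed b (fun h' => h ?_)
      rw [Fin.ext h']
  · rw [Set.eq_univ_iff_forall]
    intro x
    by_cases hx : x ∈ E n
    · exact Set.mem_iUnion.2 ⟨none, hx⟩
    · have hx : x ∈ ⋃ k, ⋃ (_ : k < n), b k := not_not.1 hx
      obtain ⟨k, hk, hxk⟩ := Set.mem_iUnion₂.1 hx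
      have hx2 : x ∈ partialSups b k := le_partialSups b k hxk
      rw [← biUnion_Iic_disjointed] at hx2
      obtain ⟨l, hl, hxl⟩ := Set.mem_iUnion₂.1 hx2
      exact Set.mem_iUnion.2 ⟨some ⟨l, lt_of_le_of_lt (Finset.mem_Iic.1 hl) hk⟩, hxl⟩
  · intro k x hx y hy
    have h1 := disjointed_subset b k hx
    have h2 := disjointed_subset b k hy
    simp only [b, Metric.mem_ball] at h1 h2
    have := dist_triangle_right x y (u k)
    linarith
  · exact ENNReal.toReal_le_of_le_ofReal hη.le hn.le

open Classical in
lemma approx_coupling {Z : Type*} [MetricSpace Z] [TopologicalSpace.SeparableSpace Z] [Nonempty Z]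
    [MeasurableSpace Z] [BorelSpace Z] (μ ν : Measure Z) [IsFiniteMeasure μ] [IsFiniteMeasure ν]
    (heq : μ Set.univ = ν Set.univ) (s c t : ℝ) (hs : 0 ≤ s) (hc : 0 ≤ c) (ht : 0 < t)
    (h : ∀ A : Set Z, IsClosed A → μ A ≤ ν (Metric.cthickening s A) + ENNReal.ofReal c) :
    ∃ α : Measure (Z × Z), α.map Prod.fst = μ ∧ α.map Prod.snd = ν ∧
      α {p : Z × Z | s + t < dist p.1 p.2} ≤ ENNReal.ofReal (c + t) := by
  obtain ⟨n, A, hAm, hAd, hAu, hAδ, hAη⟩ := partition_fin (μ + ν) (t / 4) (t / 4)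
    (by positivity) (by positivity)
  have hμη : μ.real (A none) ≤ t / 4 := by
    refine le_trans ?_ hAη
    rw [measureReal_add_apply]; simp
  have hνη : ν.real (A none) ≤ t / 4 := by
    refine le_trans ?_ hAη
    rw [measureReal_add_apply]; simp
  have hfin : ∀ (m : Measure Z) [IsFiniteMeasure m] (S : Finset (Option (Fin n))),
      ∑ i ∈ S, m.real (A i) = m.real (⋃ i ∈ S, A i) := by
    intro m _ S
    rw [measureReal_biUnion_finset (fun i _ j _ hij => hAd hij) (fun i _ => hAm i)]
  have htot : ∑ i, μ.real (A i) = ∑ i, ν.real (A i) := by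
    rw [hfin, hfin]
    simp only [Finset.mem_univ, Set.iUnion_true, hAu]
    rw [measureReal_def, measureReal_def, heq]
  let R : Option (Fin n) → Option (Fin n) → Prop := fun i j =>
    ∀ x ∈ A i, ∀ y ∈ A j, dist x y ≤ s + t
  obtain ⟨w, hw0, hw1, hw2, hw3⟩ := hall_coupling (fun i => μ.real (A i)) (fun i => ν.real (A i))
    (fun i => measureReal_nonneg) (fun i => measureReal_nonneg) htot R (c + t / 2)
    (by positivity) (by
      intro S
      set T : Finset (Option (Fin n)) := Finset.univ.filter (fun j => ∃ i ∈ S, R i j) with hT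
      rw [hfin μ S, hfin ν T]
      set U : Set Z := ⋃ i ∈ S.erase none, A i with hU
      have h1 : μ.real (⋃ i ∈ S, A i) ≤ μ.real U + t / 4 := by
        refine (measureReal_mono (s₂ := U ∪ A none) ?_).trans
          ((measureReal_union_le _ _).trans (by linarith))
        intro x hx
        obtain ⟨i, hi, hxi⟩ := Set.mem_iUnion₂.1 hx
        by_cases hin : i = none
        · right; rwa [hin] at hxi
        · left; exact Set.mem_iUnion₂.2 ⟨i, Finset.mem_erase.2 ⟨hin, hi⟩, hxi⟩
      have h2 : μ.real U ≤ ν.real (Metric.cthickening s U) + c := by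
        have := h (closure U) isClosed_closure
        rw [Metric.cthickening_closure] at this
        have := (measure_mono (subset_closure (s := U))).trans this
        have := ENNReal.toReal_mono (by finiteness) this
        rwa [ENNReal.toReal_add (by finiteness) (by finiteness), ENNReal.toReal_ofReal hc] at this
      have h3 : ν.real (Metric.cthickening s U) ≤ ν.real (⋃ i ∈ T, A i) + t / 4 := by
        refine (measureReal_mono (s₂ := (⋃ i ∈ T, A i) ∪ A none) ?_).trans
          ((measureReal_union_le _ _).trans (by linarith))
        intro y hy
        have hy' := Metric.cthickening_subset_thickening' (by positivity : 0 < s + t / 4)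
          (by linarith) U hy
        obtain ⟨x, hx, hxy⟩ := Metric.mem_thickening_iff.1 hy'
        obtain ⟨i, hi, hxi⟩ := Set.mem_iUnion₂.1 hx
        obtain ⟨hi0, hiS⟩ := Finset.mem_erase.1 hi
        obtain ⟨j, hyj⟩ := Set.mem_iUnion.1 (hAu ▸ Set.mem_univ y : y ∈ ⋃ i, A i)
        rcases j with _ | l
        · right; exact hyj
        · left
          rcases i with _ | k
          · exact absurd rfl hi0
          refine Set.mem_iUnion₂.2 ⟨some l, ?_, hyj⟩
          rw [hT, Finset.mem_filter]
          refine ⟨Finset.mem_univ _, some k, hiS, ?_⟩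
          intro x' hx' y' hy'
          have e1 := hAδ k x' hx' x hxi
          have e2 := hAδ l y hyj y' hy'
          have e3 := dist_triangle4 x' x y y'
          rw [dist_comm] at hxy
          linarith
      linarith) (t / 2) (by positivity)
  refine glue μ ν A hAm hAd hAu w hw0 hw1 hw2 R _ ?_ (c + t) (hw3.trans (by linarith))
  intro i j hR x hx y hy hxy
  exact absurd (hR x hx y hy) (not_le.2 hxy)

lemma limit_coupling {Z : Type*} [MetricSpace Z] [CompleteSpace Z]
    [TopologicalSpace.SeparableSpace Z] [MeasurableSpace Z] [BorelSpace Z]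
    (μ ν : Measure Z) [IsProbabilityMeasure μ] [IsProbabilityMeasure ν] (s c : ℝ)
    (h : ∀ t > 0, ∃ α : Measure (Z × Z), α.map Prod.fst = μ ∧ α.map Prod.snd = ν ∧
      α {p : Z × Z | s + t < dist p.1 p.2} ≤ ENNReal.ofReal (c + t)) :
    ∃ α : Measure (Z × Z), α.map Prod.fst = μ ∧ α.map Prod.snd = ν ∧
      α {p : Z × Z | s < dist p.1 p.2} ≤ ENNReal.ofReal c := by
  have : SecondCountableTopology Z := UniformSpace.secondCountable_of_separable Z
  have hprob : ∀ α : Measure (Z × Z), α.map Prod.fst = μ → IsProbabilityMeasure α := by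
    intro α hα
    refine ⟨?_⟩
    rw [← measure_univ (μ := μ), ← hα, Measure.map_apply measurable_fst MeasurableSet.univ,
      Set.preimage_univ]
  let K : Set (ProbabilityMeasure (Z × Z)) :=
    {α | (α : Measure (Z × Z)).map Prod.fst = μ ∧ (α : Measure (Z × Z)).map Prod.snd = ν}
  have hK : IsCompact (closure K) := by
    apply isCompact_closure_of_isTightMeasureSet
    apply IsTightMeasureSet.prodMk
    · refine (isTightMeasureSet_singleton (μ := μ)).subset ?_
      rintro _ ⟨_, ⟨α, hα, rfl⟩, rfl⟩
      exact hα.1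
    · refine (isTightMeasureSet_singleton (μ := ν)).subset ?_
      rintro _ ⟨_, ⟨α, hα, rfl⟩, rfl⟩
      exact hα.2
  have hex : ∀ n : ℕ, ∃ α : ProbabilityMeasure (Z × Z), α ∈ K ∧
      (α : Measure (Z × Z)) {p : Z × Z | s + 1 / ((n : ℝ) + 1) < dist p.1 p.2}
        ≤ ENNReal.ofReal (c + 1 / ((n : ℝ) + 1)) := by
    intro n
    obtain ⟨α, h1, h2, h3⟩ := h (1 / ((n : ℝ) + 1)) (by positivity)
    exact ⟨⟨α, hprob α h1⟩, ⟨h1, h2⟩, h3⟩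
  choose a haK ha using hex
  let F : Ultrafilter ℕ := hyperfilter ℕ
  have hF : (F : Filter ℕ) ≤ atTop := by
    rw [← Nat.cofinite_eq_atTop]; exact hyperfilter_le_cofinite
  obtain ⟨α, -, hα⟩ := hK.ultrafilter_le_nhds' (F.map a)
    (by
      rw [Ultrafilter.mem_map]
      exact Filter.univ_mem' fun n => subset_closure (haK n))
  have hα : Tendsto a F (𝓝 α) := hα
  have hmap : ∀ (f : Z × Z → Z) (hf : Continuous f) (m : Measure Z) [IsProbabilityMeasure m],
      (∀ n, (a n : Measure (Z × Z)).map f = m) → (α : Measure (Z × Z)).map f = m := by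
    intro f hf m hm hn
    have h1 := ProbabilityMeasure.tendsto_map_of_tendsto_of_continuous _ _ hα hf
    have h2 : (fun n => (a n).map hf.measurable.aemeasurable) = fun _ => (⟨m, hm⟩ : ProbabilityMeasure Z) := by
      funext n
      exact Subtype.ext (hn n)
    rw [h2] at h1
    have := tendsto_nhds_unique h1 tendsto_const_nhds
    exact congrArg Subtype.val this
  refine ⟨α, hmap _ continuous_fst μ fun n => (haK n).1, hmap _ continuous_snd ν fun n => (haK n).2, ?_⟩
  have hlim : Tendsto (fun n : ℕ => (1 : ℝ) / ((n : ℝ) + 1)) atTop (𝓝 0) :=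
    tendsto_one_div_add_atTop_nhds_zero_nat
  have hclim : Tendsto (fun n : ℕ => ENNReal.ofReal (c + 1 / ((n : ℝ) + 1))) F
      (𝓝 (ENNReal.ofReal c)) := by
    have := ENNReal.tendsto_ofReal (hlim.const_add c)
    rw [add_zero] at this
    exact this.mono_left hF
  have hk : ∀ k : ℕ, (α : Measure (Z × Z)) {p : Z × Z | s + 1 / ((k : ℝ) + 1) < dist p.1 p.2}
      ≤ ENNReal.ofReal c := by
    intro k
    have hopen : IsOpen {p : Z × Z | s + 1 / ((k : ℝ) + 1) < dist p.1 p.2} :=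
      isOpen_lt continuous_const (continuous_fst.dist continuous_snd)
    refine (ProbabilityMeasure.le_liminf_measure_open_of_tendsto hα hopen).trans ?_
    rw [← hclim.liminf_eq]
    refine liminf_le_liminf ?_
    filter_upwards [hF (eventually_ge_atTop k)] with n hn
    refine (measure_mono ?_).trans (ha n)
    intro p hp
    have : (1 : ℝ) / ((n : ℝ) + 1) ≤ 1 / ((k : ℝ) + 1) := by
      have : (k : ℝ) ≤ n := by exact_mod_cast hn
      gcongr
    simp only [Set.mem_ofPred_eq] at hp ⊢
    linarith
  have hun : {p : Z × Z | s < dist p.1 p.2}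
      = ⋃ k : ℕ, {p : Z × Z | s + 1 / ((k : ℝ) + 1) < dist p.1 p.2} := by
    ext p
    simp only [Set.mem_ofPred_eq, Set.mem_iUnion]
    constructor
    · intro hp
      obtain ⟨k, hk⟩ := exists_nat_one_div_lt (sub_pos.2 hp)
      exact ⟨k, by linarith⟩
    · rintro ⟨k, hk⟩
      have : (0 : ℝ) < 1 / ((k : ℝ) + 1) := by positivity
      linarith
  rw [hun, Monotone.measure_iUnion]
  · exact iSup_le hk
  · intro k l hkl p hp
    have : (1 : ℝ) / ((l : ℝ) + 1) ≤ 1 / ((k : ℝ) + 1) := by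
      have : (k : ℝ) ≤ l := by exact_mod_cast hkl
      gcongr
    simp only [Set.mem_ofPred_eq] at hp ⊢
    linarith

lemma prob_strassen {Z : Type*} [MetricSpace Z] [CompleteSpace Z]
    [TopologicalSpace.SeparableSpace Z] [MeasurableSpace Z] [BorelSpace Z]
    (μ ν : Measure Z) [IsProbabilityMeasure μ] [IsProbabilityMeasure ν] (s c : ℝ)
    (hs : 0 ≤ s) (hc : 0 ≤ c)
    (h : ∀ t > 0, ∃ r, 0 < r ∧ r < s + t ∧ ∀ A : Set Z, IsClosed A →
      μ A ≤ ν (Metric.cthickening r A) + ENNReal.ofReal (c + t)) :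
    ∃ α : Measure (Z × Z), α.map Prod.fst = μ ∧ α.map Prod.snd = ν ∧
      α {p : Z × Z | s < dist p.1 p.2} ≤ ENNReal.ofReal c := by
  have : Nonempty Z := nonempty_of_isProbabilityMeasure μ
  refine limit_coupling μ ν s c fun t ht => ?_
  obtain ⟨r, hr0, hr, hA⟩ := h (t / 2) (by positivity)
  obtain ⟨α, h1, h2, h3⟩ := approx_coupling μ ν (by simp) r (c + t / 2) (t / 2) hr0.le
    (by positivity) (by positivity) hA
  refine ⟨α, h1, h2, (measure_mono ?_).trans (h3.trans (ENNReal.ofReal_le_ofReal (by linarith)))⟩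
  intro p hp
  simp only [Set.mem_ofPred_eq] at hp ⊢
  linarith

/-- **Strassen's theorem.** If `μ` and `ν` are finite Borel measures on a complete separable
metric space with equal total mass and `ε := dP(μ,ν)`, then there is a coupling `α` of `μ`
and `ν` with `α {(x,y) | d(x,y) > ε} ≤ ε`. -/
theorem strassen {Z : Type*} [MetricSpace Z] [CompleteSpace Z]
    [TopologicalSpace.SeparableSpace Z] [MeasurableSpace Z] [BorelSpace Z]
    (μ ν : Measure Z) [IsFiniteMeasure μ] [IsFiniteMeasure ν]
    (heq : μ Set.univ = ν Set.univ) :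
    ∃ α : Measure (Z × Z), α.map Prod.fst = μ ∧ α.map Prod.snd = ν ∧
      α {p : Z × Z | prokhorovDist μ ν < dist p.1 p.2} ≤
        ENNReal.ofReal (prokhorovDist μ ν) := by
  by_cases hμ0 : μ Set.univ = 0
  · refine ⟨0, ?_, ?_, by simp⟩
    · rw [Measure.map_zero, Measure.measure_univ_eq_zero.1 hμ0]
    · rw [Measure.map_zero, Measure.measure_univ_eq_zero.1 (heq.symm.trans hμ0)]
  set ε := prokhorovDist μ ν with hε
  have hε0 : 0 ≤ ε := Real.sInf_nonneg fun x hx => hx.1.le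
  obtain ⟨M, hM0, hM⟩ : ∃ M : ℝ, 0 < M ∧ μ Set.univ = ENNReal.ofReal M :=
    ⟨μ.real Set.univ, ENNReal.toReal_pos hμ0 (measure_ne_top _ _), by simp⟩
  have hadm : ∀ t > 0, ∃ r, 0 < r ∧ r < ε + t ∧ ∀ A : Set Z, IsClosed A →
      μ A ≤ ν (Metric.cthickening r A) + ENNReal.ofReal r := by
    intro t ht
    obtain ⟨r, hr, hrt⟩ := exists_lt_of_csInf_lt
      (s := {ε : ℝ | 0 < ε ∧ ∀ A : Set Z, IsClosed A →
        μ A ≤ ν (Metric.cthickening ε A) + ENNReal.ofReal ε ∧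
        ν A ≤ μ (Metric.cthickening ε A) + ENNReal.ofReal ε}) (b := ε + t)
      ⟨M, hM0, fun A _ => ⟨(measure_mono (Set.subset_univ A)).trans (hM ▸ le_add_self),
        (measure_mono (Set.subset_univ A)).trans (heq ▸ hM ▸ le_add_self)⟩⟩ (show ε < ε + t by linarith)
    exact ⟨r, hr.1, hrt, fun A hA => (hr.2 A hA).1⟩
  set k : ENNReal := ENNReal.ofReal M⁻¹ with hk
  set K : ENNReal := ENNReal.ofReal M with hK
  have hkK : k * K = 1 := by
    rw [hk, hK, ← ENNReal.ofReal_mul (by positivity), inv_mul_cancel₀ hM0.ne', ENNReal.ofReal_one]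
  have hKk : K * k = 1 := by rw [mul_comm, hkK]
  have : IsProbabilityMeasure (k • μ) := ⟨by simp [hM, hkK]⟩
  have : IsProbabilityMeasure (k • ν) := ⟨by simp [← heq, hM, hkK]⟩
  obtain ⟨α, h1, h2, h3⟩ := prob_strassen (k • μ) (k • ν) ε (M⁻¹ * ε) hε0 (by positivity) (by
    intro t ht
    obtain ⟨r, hr0, hr, hA⟩ := hadm (min t (M * t)) (by positivity)
    refine ⟨r, hr0, hr.trans_le (by gcongr; exact min_le_left _ _), fun A hAc => ?_⟩
    calc (k • μ) A = k * μ A := by simp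
      _ ≤ k * (ν (Metric.cthickening r A) + ENNReal.ofReal r) := by gcongr; exact hA A hAc
      _ = (k • ν) (Metric.cthickening r A) + ENNReal.ofReal (M⁻¹ * r) := by
        rw [mul_add, hk, ← ENNReal.ofReal_mul (by positivity)]; simp
      _ ≤ _ := by
        gcongr
        calc M⁻¹ * r ≤ M⁻¹ * (ε + M * t) := by
              gcongr; exact hr.le.trans (by gcongr; exact min_le_right _ _)
          _ = M⁻¹ * ε + t := by field_simp)
  refine ⟨K • α, ?_, ?_, ?_⟩
  · rw [Measure.map_smul, h1, smul_smul, hKk, one_smul]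
  · rw [Measure.map_smul, h2, smul_smul, hKk, one_smul]
  · calc (K • α) {p : Z × Z | ε < dist p.1 p.2} = K * α {p : Z × Z | ε < dist p.1 p.2} := by simp
      _ ≤ K * ENNReal.ofReal (M⁻¹ * ε) := by gcongr
      _ = ENNReal.ofReal ε := by
        rw [ENNReal.ofReal_mul (by positivity), ← mul_assoc, hKk, one_mul]

end
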